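/- arXiv:1606.00324 — 2 statements merged into one kernel-verified Lean document; each statement's English description precedes it below -/
import Mathlib

section
/- For any hypergraph communication situation (N,v,H), any positive integer k≥1, and any player i∈N, the position value satisfies π_i(N,v,H) = Σ_{l∈U(H)^k(i)} Sh_l(U(H)^k,w^k), where (U(H)^k,w^k) is the k-augmented uniform hyperlink game of (N,v,H). -/
open scoped Classical
open Finset

noncomputable section

namespace HGGame

/-! ## Generic hypergraph notions -/

variable {α : Type*}

/-- Two nodes are linked if they lie in a common hyperlink of `E`. -/
def Linked (E : Finset (Finset α)) (a b : α) : Prop :=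
  ∃ e ∈ E, a ∈ e ∧ b ∈ e

/-- The component of `i` in the subhypergraph of `(α, E)` induced by the ground set `S`
(only hyperlinks contained in `S` count). -/
def compOf (E : Finset (Finset α)) (S : Finset α) (i : α) : Finset α :=
  S.filter (fun j => Relation.ReflTransGen (Linked (E.filter (fun e => e ⊆ S))) i j)

/-- The set `S/E` of components of the subhypergraph induced by `S`. -/
def components (E : Finset (Finset α)) (S : Finset α) : Finset (Finset α) :=
  S.image (compOf E S)

/-- The hypergraph-restricted worth `v^E(S) = Σ_{T ∈ S/E} v(T)`. -/
def restrictedWorth (v : Finset α → ℝ) (E : Finset (Finset α)) (S : Finset α) : ℝ :=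
  ∑ T ∈ components E S, v T

/-! ## Shapley value -/

/-- The set `σ^i` of players preceding `i` in the ordering `σ`. -/
def preceding {M : Type*} [Fintype M] (σ : M ≃ Fin (Fintype.card M)) (i : M) : Finset M :=
  Finset.univ.filter (fun j => σ j < σ i)

/-- The marginal contribution `m^σ_i(u) = u(σ^i ∪ {i}) - u(σ^i)`. -/
def marginal {M : Type*} [Fintype M] (u : Finset M → ℝ) (σ : M ≃ Fin (Fintype.card M))
    (i : M) : ℝ :=
  u (insert i (preceding σ i)) - u (preceding σ i)

/-- The Shapley value of the TU-game `(M, u)`. -/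
def shapley {M : Type*} [Fintype M] (u : Finset M → ℝ) (i : M) : ℝ :=
  ((Fintype.card M).factorial : ℝ)⁻¹ * ∑ σ : M ≃ Fin (Fintype.card M), marginal u σ i

/-- The Harsanyi dividend `λ_T(u) = Σ_{∅ ≠ S ⊆ T} (-1)^{|T|-|S|} u(S)`. -/
def dividend {M : Type*} (u : Finset M → ℝ) (T : Finset M) : ℝ :=
  ∑ S ∈ T.powerset.filter (fun S => S ≠ ∅), (-1 : ℝ) ^ (T.card - S.card) * u S

/-! ## Hypergraph communication situations -/

variable {N : Type*} [Fintype N] [DecidableEq N]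

/-- The conference game `(H, v^N)`, a TU-game with player set `H`:
`v^N(H') = Σ_{T ∈ N/H'} v(T)`. -/
def confGame (v : Finset N → ℝ) (H : Finset (Finset N)) (F : Finset {e // e ∈ H}) : ℝ :=
  restrictedWorth v (F.image Subtype.val) Finset.univ

/-- The position value `π_i(N,v,H) = Σ_{e ∈ H_i} (1/|e|) · Sh_e(H, v^N)`. -/
def positionValue (v : Finset N → ℝ) (H : Finset (Finset N)) (i : N) : ℝ :=
  ∑ e ∈ H.attach.filter (fun e => i ∈ e.val),
    ((e.val.card : ℝ))⁻¹ * shapley (confGame v H) e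

/-! ## The uniform hyperlink game -/

/-- The type of agents `(i, e, k)` of the uniform hyperlink game. -/
abbrev UElem (N : Type*) := N × Finset N × ℕ

/-- `η(H)`: the least common multiple of the hyperlink sizes. -/
def eta (H : Finset (Finset N)) : ℕ := H.lcm Finset.card

/-- `U(H)(i,e) = {(i,e,k) : k = 1, …, η(H)/|e|}`. -/
def UHie (H : Finset (Finset N)) (i : N) (e : Finset N) : Finset (UElem N) :=
  (Finset.Icc 1 (eta H / e.card)).image fun k => (i, e, k)

/-- `U(H)(i) = ∪_{e ∈ H_i} U(H)(i,e)`. -/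
def UHi (H : Finset (Finset N)) (i : N) : Finset (UElem N) :=
  (H.filter (fun e => i ∈ e)).biUnion fun e => UHie H i e

/-- `U(H)(e) = ∪_{i ∈ e} U(H)(i,e)`. -/
def UHe (H : Finset (Finset N)) (e : Finset N) : Finset (UElem N) :=
  e.biUnion fun i => UHie H i e

/-- `U(H) = ∪_{i ∈ N} U(H)(i)`. -/
def UH (H : Finset (Finset N)) : Finset (UElem N) :=
  Finset.univ.biUnion fun i : N => UHi H i

/-- `H[S] = {e ∈ H : U(H)(e) ⊆ S}`. -/
def Hof (H : Finset (Finset N)) (S : Finset (UElem N)) : Finset (Finset N) :=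
  H.filter fun e => UHe H e ⊆ S

/-- The characteristic function `w(S) = Σ_{R ∈ N/H[S]} v(R)` of the uniform hyperlink game. -/
def uw (v : Finset N → ℝ) (H : Finset (Finset N)) (S : Finset (UElem N)) : ℝ :=
  restrictedWorth v (Hof H S) Finset.univ

/-- The uniform hyperlink game `(U(H), w)` as a TU-game with player set `U(H)`. -/
def uGame (v : Finset N → ℝ) (H : Finset (Finset N)) (F : Finset {l // l ∈ UH H}) : ℝ :=
  uw v H (F.image Subtype.val)

/-! ## The k-augmented uniform hyperlink game -/

variable {N : Type*} [Fintype N] [DecidableEq N]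

/-- `U(H)^k(i,e) = {(i,e,t) : t = 1, …, ρ(k)/|e|}` with `ρ(k) = k·η(H)`. -/
def UkHie (H : Finset (Finset N)) (k : ℕ) (i : N) (e : Finset N) : Finset (UElem N) :=
  (Finset.Icc 1 (k * eta H / e.card)).image fun t => (i, e, t)

/-- `U(H)^k(i) = ∪_{e ∈ H_i} U(H)^k(i,e)`. -/
def UkHi (H : Finset (Finset N)) (k : ℕ) (i : N) : Finset (UElem N) :=
  (H.filter (fun e => i ∈ e)).biUnion fun e => UkHie H k i e

/-- `U(H)^k(e) = ∪_{i ∈ e} U(H)^k(i,e)`. -/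
def UkHe (H : Finset (Finset N)) (k : ℕ) (e : Finset N) : Finset (UElem N) :=
  e.biUnion fun i => UkHie H k i e

/-- `U(H)^k = ∪_{i ∈ N} U(H)^k(i)`. -/
def UHk (H : Finset (Finset N)) (k : ℕ) : Finset (UElem N) :=
  Finset.univ.biUnion fun i : N => UkHi H k i

/-- `H[S] = {e ∈ H : U(H)^k(e) ⊆ S}`. -/
def Hofk (H : Finset (Finset N)) (k : ℕ) (S : Finset (UElem N)) : Finset (Finset N) :=
  H.filter fun e => UkHe H k e ⊆ S

/-- The characteristic function `w^k(S) = Σ_{R ∈ N/H[S]} v(R)`. -/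
def uwk (v : Finset N → ℝ) (H : Finset (Finset N)) (k : ℕ) (S : Finset (UElem N)) : ℝ :=
  restrictedWorth v (Hofk H k S) Finset.univ

/-- The `k`-augmented uniform hyperlink game `(U(H)^k, w^k)` as a TU-game. -/
def ukGame (v : Finset N → ℝ) (H : Finset (Finset N)) (k : ℕ)
    (F : Finset {l // l ∈ UHk H k}) : ℝ :=
  uwk v H k (F.image Subtype.val)

/-! ## Unanimity games and the Shapley value -/

/-- Coefficients of a game in the basis of unanimity games. -/
def unanimityCoeff {M : Type*} (u : Finset M → ℝ) (T : Finset M) : ℝ :=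
  u T - ∑ S ∈ T.ssubsets.attach, unanimityCoeff u S.1
termination_by T.card
decreasing_by exact Finset.card_lt_card (Finset.mem_ssubsets.1 S.2)

lemma eq_sum_unanimityCoeff {M : Type*} [Fintype M] (u : Finset M → ℝ) (S : Finset M) :
    u S = ∑ T : Finset M, unanimityCoeff u T * (if T ⊆ S then 1 else 0) := by
  have h := unanimityCoeff.eq_1 u S
  rw [Finset.sum_attach S.ssubsets (unanimityCoeff u)] at h
  have hS : (Finset.univ.filter fun T : Finset M => T ⊆ S) = insert S S.ssubsets := by
    ext T
    simp only [Finset.mem_filter, Finset.mem_univ, true_and, Finset.mem_insert,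
      Finset.mem_ssubsets]
    exact subset_iff_ssubset_or_eq.trans or_comm
  simp only [mul_ite, mul_one, mul_zero]
  rw [← Finset.sum_filter, hS, Finset.sum_insert (by simp), h]
  ring

/-- The Shapley value is linear. -/
lemma shapley_sum_mul {M ι : Type*} [Fintype M] [Fintype ι] (c : ι → ℝ)
    (u : ι → Finset M → ℝ) (i : M) :
    shapley (fun S => ∑ t, c t * u t S) i = ∑ t, c t * shapley (u t) i := by
  simp only [shapley, marginal, ← Finset.sum_sub_distrib, ← mul_sub]
  rw [Finset.sum_comm, Finset.mul_sum]
  refine Finset.sum_congr rfl fun t _ => ?_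
  rw [← Finset.mul_sum]
  ring

/-- All members of `T` come last among `T` in equally many orderings. -/
lemma sum_last_eq {M : Type*} [Fintype M] (T : Finset M) {i j : M} (hi : i ∈ T) (hj : j ∈ T) :
    (∑ σ : M ≃ Fin (Fintype.card M), if ∀ x ∈ T, σ x ≤ σ i then (1 : ℝ) else 0) =
      ∑ σ : M ≃ Fin (Fintype.card M), if ∀ x ∈ T, σ x ≤ σ j then (1 : ℝ) else 0 := by
  refine Fintype.sum_equiv (Equiv.equivCongr (Equiv.swap i j) (Equiv.refl _)) _ _ fun σ => ?_
  have hT : ∀ x, Equiv.swap i j x ∈ T ↔ x ∈ T := by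
    intro x
    rw [Equiv.swap_apply_def]
    split_ifs with h₁ h₂ <;> simp_all
  congr 1
  simp only [Equiv.equivCongr_apply_apply, Equiv.symm_swap, Equiv.swap_apply_right,
    Equiv.refl_apply, eq_iff_iff]
  refine ⟨fun h x hx => h _ ((hT x).2 hx), fun h x hx => ?_⟩
  simpa using h _ ((hT x).2 hx)

lemma sum_last_mul_card {M : Type*} [Fintype M] (T : Finset M) {i : M} (hi : i ∈ T) :
    (T.card : ℝ) *
        (∑ σ : M ≃ Fin (Fintype.card M), if ∀ x ∈ T, σ x ≤ σ i then (1 : ℝ) else 0) =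
      (Fintype.card M).factorial := by
  rw [← nsmul_eq_mul, ← Finset.sum_const, Finset.sum_congr rfl fun j hj => sum_last_eq T hi hj,
    Finset.sum_comm]
  have h : ∀ σ : M ≃ Fin (Fintype.card M),
      (∑ j ∈ T, if ∀ x ∈ T, σ x ≤ σ j then (1 : ℝ) else 0) = 1 := by
    intro σ
    obtain ⟨m, hm, hmax⟩ := Finset.exists_max_image T σ ⟨i, hi⟩
    rw [Finset.sum_eq_single_of_mem m hm, if_pos hmax]
    intro j hj hjm
    exact if_neg fun h => hjm (σ.injective (le_antisymm (hmax j hj) (h m hm)))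
  rw [Finset.sum_congr rfl fun σ _ => h σ, Finset.sum_const, Finset.card_univ,
    Fintype.card_equiv (Fintype.equivFin M)]
  simp

lemma shapley_unanimity {M : Type*} [Fintype M] (T : Finset M) (i : M) :
    shapley (fun S => if T ⊆ S then 1 else 0) i = if i ∈ T then (T.card : ℝ)⁻¹ else 0 := by
  split_ifs with hi
  · have hm : ∀ σ : M ≃ Fin (Fintype.card M),
        marginal (fun S => if T ⊆ S then 1 else 0) σ i =
          if ∀ x ∈ T, σ x ≤ σ i then (1 : ℝ) else 0 := by
      intro σ
      have h₁ : ¬ T ⊆ preceding σ i := fun h => by simpa [preceding] using h hi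
      have h₂ : T ⊆ insert i (preceding σ i) ↔ ∀ x ∈ T, σ x ≤ σ i := by
        refine forall₂_congr fun x _ => ?_
        simp [preceding, le_iff_eq_or_lt]
      simp [marginal, h₁, h₂]
    have hT : (T.card : ℝ) ≠ 0 := Nat.cast_ne_zero.2 (Finset.card_ne_zero_of_mem hi)
    have hM : ((Fintype.card M).factorial : ℝ) ≠ 0 := Nat.cast_ne_zero.2 (Nat.factorial_ne_zero _)
    have hs := sum_last_mul_card T hi
    rw [shapley, Finset.sum_congr rfl fun σ _ => hm σ]
    field_simp
    linarith
  · simp [shapley, marginal, Finset.subset_insert_iff_of_notMem hi]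

/-- If every player `e` of a game is replaced by `ρ` agents, all of which are needed for `e` to
act, then the agents of `e` share the Shapley value of `e` equally. -/
lemma shapley_fiber {M L : Type*} [Fintype M] [Fintype L] (p : M → L) (ρ : ℕ)
    (hp : ∀ e, (Finset.univ.filter fun l => p l = e).card = ρ) (u : Finset L → ℝ) (l : M) :
    shapley (fun F => u (Finset.univ.filter fun e => ∀ m, p m = e → m ∈ F)) l =
      (ρ : ℝ)⁻¹ * shapley u (p l) := by
  have hF : ∀ (T : Finset L) (F : Finset M),
      (T ⊆ Finset.univ.filter fun e => ∀ m, p m = e → m ∈ F) ↔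
        (Finset.univ.filter fun m => p m ∈ T) ⊆ F := by
    intro T F
    simp only [Finset.subset_iff, Finset.mem_filter, Finset.mem_univ, true_and]
    exact ⟨fun h m hm => h hm m rfl, fun h e he m hm => h (hm ▸ he)⟩
  have hcard : ∀ T : Finset L, (Finset.univ.filter fun m => p m ∈ T).card = T.card * ρ := by
    intro T
    rw [Finset.card_eq_sum_card_fiberwise (f := p) (t := T) (fun m hm => by simpa using hm),
      Finset.sum_const_nat]
    intro e he
    rw [← hp e, Finset.filter_filter]
    congr 1
    ext m
    simp only [Finset.mem_filter, Finset.mem_univ, true_and, and_iff_right_iff_imp]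
    rintro rfl
    exact he
  have hu : u = fun S => ∑ T : Finset L, unanimityCoeff u T * (if T ⊆ S then 1 else 0) :=
    funext (eq_sum_unanimityCoeff u)
  generalize unanimityCoeff u = c at hu
  subst hu
  simp only [hF]
  rw [shapley_sum_mul, shapley_sum_mul, Finset.mul_sum]
  refine Finset.sum_congr rfl fun T _ => ?_
  rw [shapley_unanimity, shapley_unanimity, hcard]
  simp only [Finset.mem_filter, Finset.mem_univ, true_and]
  split_ifs
  · push_cast
    rw [mul_inv]
    ring
  · simp

/-! ## The agents of a hyperlink -/

lemma card_dvd_mul_eta {N : Type*} {H : Finset (Finset N)} (k : ℕ) {e : Finset N} (he : e ∈ H) :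
    e.card ∣ k * eta H :=
  (Finset.dvd_lcm he).mul_left k

lemma mem_UkHie {N : Type*} [DecidableEq N] {H : Finset (Finset N)} {k : ℕ} {i : N}
    {e : Finset N} {l : UElem N} :
    l ∈ UkHie H k i e ↔ l.1 = i ∧ l.2.1 = e ∧ l.2.2 ∈ Finset.Icc 1 (k * eta H / e.card) := by
  obtain ⟨j, f, t⟩ := l
  simp only [UkHie, Finset.mem_image, Prod.mk.injEq]
  constructor
  · rintro ⟨t, ht, rfl, rfl, rfl⟩
    exact ⟨rfl, rfl, ht⟩
  · rintro ⟨rfl, rfl, ht⟩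
    exact ⟨t, ht, rfl, rfl, rfl⟩

lemma card_UkHie {N : Type*} [DecidableEq N] (H : Finset (Finset N)) (k : ℕ) (i : N)
    (e : Finset N) :
    (UkHie H k i e).card = k * eta H / e.card := by
  rw [UkHie, Finset.card_image_of_injective _ fun a b h => by simpa using h]
  simp

lemma mem_UkHi {N : Type*} [DecidableEq N] {H : Finset (Finset N)} {k : ℕ} {i : N} {l : UElem N} :
    l ∈ UkHi H k i ↔ l.2.1 ∈ H ∧ i ∈ l.2.1 ∧ l ∈ UkHie H k i l.2.1 := by
  simp only [UkHi, Finset.mem_biUnion, Finset.mem_filter]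
  constructor
  · rintro ⟨e, ⟨he, hi⟩, hl⟩
    obtain rfl := (mem_UkHie.1 hl).2.1
    exact ⟨he, hi, hl⟩
  · rintro ⟨he, hi, hl⟩
    exact ⟨_, ⟨he, hi⟩, hl⟩

lemma mem_UkHe {N : Type*} [DecidableEq N] {H : Finset (Finset N)} {k : ℕ}
    {e : Finset N} {l : UElem N} :
    l ∈ UkHe H k e ↔ l.1 ∈ e ∧ l ∈ UkHie H k l.1 e := by
  simp only [UkHe, Finset.mem_biUnion]
  constructor
  · rintro ⟨i, hi, hl⟩
    obtain rfl := (mem_UkHie.1 hl).1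
    exact ⟨hi, hl⟩
  · rintro ⟨hi, hl⟩
    exact ⟨_, hi, hl⟩

lemma mem_UHk {H : Finset (Finset N)} {k : ℕ} {l : UElem N} :
    l ∈ UHk H k ↔ l ∈ UkHi H k l.1 := by
  simp only [UHk, Finset.mem_biUnion, Finset.mem_univ, true_and]
  refine ⟨?_, fun h => ⟨_, h⟩⟩
  rintro ⟨i, hl⟩
  obtain rfl := (mem_UkHie.1 (mem_UkHi.1 hl).2.2).1
  exact hl

lemma mem_UkHe_iff {H : Finset (Finset N)} {k : ℕ} {e : Finset N} (he : e ∈ H) {l : UElem N} :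
    l ∈ UkHe H k e ↔ l ∈ UHk H k ∧ l.2.1 = e := by
  rw [mem_UkHe, mem_UHk, mem_UkHi]
  constructor
  · rintro ⟨hi, hl⟩
    obtain rfl := (mem_UkHie.1 hl).2.1
    exact ⟨⟨he, hi, hl⟩, rfl⟩
  · rintro ⟨⟨-, hi, hl⟩, rfl⟩
    exact ⟨hi, hl⟩

lemma card_UkHe {N : Type*} [DecidableEq N] {H : Finset (Finset N)} (k : ℕ)
    {e : Finset N} (he : e ∈ H) :
    (UkHe H k e).card = k * eta H := by
  rw [UkHe, Finset.card_biUnion, Finset.sum_const_nat fun i _ => card_UkHie H k i e]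
  · exact Nat.mul_div_cancel' (card_dvd_mul_eta k he)
  · intro i _ j _ hij
    rw [Function.onFun, Finset.disjoint_left]
    intro l hi hj
    exact hij ((mem_UkHie.1 hi).1.symm.trans (mem_UkHie.1 hj).1)

/-- The hyperlink of an agent of the `k`-augmented uniform hyperlink game. -/
def linkOf (H : Finset (Finset N)) (k : ℕ) (l : {l // l ∈ UHk H k}) : {e // e ∈ H} :=
  ⟨l.1.2.1, (mem_UkHi.1 (mem_UHk.1 l.2)).1⟩

lemma card_linkOf_fiber (H : Finset (Finset N)) (k : ℕ) (e : {e // e ∈ H}) :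
    (Finset.univ.filter fun l => linkOf H k l = e).card = k * eta H := by
  rw [← card_UkHe k e.2, ← Finset.card_map (Function.Embedding.subtype _)]
  congr 1
  ext l
  rw [mem_UkHe_iff e.2, and_comm]
  simp [linkOf, Subtype.ext_iff]

lemma ukGame_eq (v : Finset N → ℝ) (H : Finset (Finset N)) (k : ℕ) :
    ukGame v H k = fun F =>
      confGame v H (Finset.univ.filter fun e => ∀ m, linkOf H k m = e → m ∈ F) := by
  funext F
  rw [ukGame, uwk, confGame]
  congr 1
  ext e
  simp only [Hofk, Finset.mem_filter, Finset.mem_image, Finset.mem_univ, true_and,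
    Subtype.exists, exists_and_right, exists_eq_right, Finset.subset_iff]
  constructor
  · rintro ⟨he, h⟩
    refine ⟨he, fun m hm => ?_⟩
    obtain ⟨_, hF⟩ := h ((mem_UkHe_iff he).2 ⟨m.2, congrArg Subtype.val hm⟩)
    exact hF
  · rintro ⟨he, h⟩
    refine ⟨he, fun l hl => ?_⟩
    obtain ⟨hl, hle⟩ := (mem_UkHe_iff he).1 hl
    exact ⟨hl, h ⟨l, hl⟩ (Subtype.ext hle)⟩

lemma card_agents_of_link (H : Finset (Finset N)) (k : ℕ) (i : N) (e : {e // e ∈ H})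
    (hi : i ∈ e.1) :
    (((UHk H k).attach.filter fun l => l.1 ∈ UkHi H k i).filter
      fun l => linkOf H k l = e).card = k * eta H / e.1.card := by
  rw [← card_UkHie H k i e.1, ← Finset.card_map (Function.Embedding.subtype _)]
  congr 1
  ext l
  simp only [linkOf, Finset.mem_map, Finset.mem_filter, Finset.mem_attach, true_and,
    Function.Embedding.subtype_apply, Subtype.exists, exists_and_right, exists_eq_right,
    Subtype.ext_iff]
  constructor
  · rintro ⟨⟨_, h⟩, he⟩
    exact he ▸ (mem_UkHi.1 h).2.2
  · intro h
    obtain ⟨h₁, h₂, -⟩ := mem_UkHie.1 h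
    have hl : l ∈ UkHi H k i := mem_UkHi.2 ⟨h₂ ▸ e.2, h₂ ▸ hi, h₂ ▸ h⟩
    exact ⟨⟨mem_UHk.2 (h₁ ▸ hl), hl⟩, h₂⟩

/-- Theorem 2: the position value equals the aggregated Shapley value of the
`k`-augmented uniform hyperlink game, for every positive integer `k`. -/
theorem position_value_eq_augmented_uniform_hyperlink_shapley
    (v : Finset N → ℝ) (H : Finset (Finset N))
    (hN : 2 ≤ Fintype.card N)
    (hv0 : v ∅ = 0) (hzn : ∀ i : N, v {i} = 0)
    (hH : ∀ e ∈ H, 1 < e.card)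
    (k : ℕ) (hk : 1 ≤ k) (i : N) :
    positionValue v H i =
      ∑ l ∈ (UHk H k).attach.filter (fun l => l.val ∈ UkHi H k i),
        shapley (ukGame v H k) l := by
  have hη : eta H ≠ 0 := by
    rw [eta, Ne, Finset.lcm_eq_zero_iff]
    rintro ⟨e, he, h0⟩
    have := hH e he
    omega
  have hρ : ((k * eta H : ℕ) : ℝ) ≠ 0 := Nat.cast_ne_zero.2 (Nat.mul_ne_zero (by omega) hη)
  have hsh : ∀ l, shapley (ukGame v H k) l =
      ((k * eta H : ℕ) : ℝ)⁻¹ * shapley (confGame v H) (linkOf H k l) := by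
    intro l
    rw [ukGame_eq]
    convert shapley_fiber (linkOf H k) (k * eta H)
      (fun e => by convert card_linkOf_fiber H k e) (confGame v H) l
  rw [positionValue, ← Finset.sum_fiberwise_of_maps_to (g := linkOf H k)
    (t := H.attach.filter fun e => i ∈ e.1)]
  · refine Finset.sum_congr rfl fun e he => ?_
    have hi : i ∈ e.1 := (Finset.mem_filter.1 he).2
    have hcard : (e.1.card : ℝ) ≠ 0 := Nat.cast_ne_zero.2 (Finset.card_ne_zero_of_mem hi)
    rw [Finset.sum_congr rfl (g := fun _ =>
        ((k * eta H : ℕ) : ℝ)⁻¹ * shapley (confGame v H) e) fun l hl => by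
          rw [hsh, (Finset.mem_filter.1 hl).2],
      Finset.sum_const, card_agents_of_link H k i e hi, nsmul_eq_mul,
      Nat.cast_div (card_dvd_mul_eta k e.2) hcard]
    field_simp
  · intro l hl
    exact Finset.mem_filter.2 ⟨Finset.mem_attach _ _,
      (mem_UkHi.1 (Finset.mem_filter.1 hl).2).2.1⟩

end HGGame
end
end

section
/- Let (N,v,H) be a hypergraph communication situation with uniform hyperlink game (U(H),w). For an ordering σ of U(H), let g(σ) be the ordering of H defined by: g(σ)(e_1)<g(σ)(e_2) if and only if max{σ(l) : l∈U(H)(e_1)} < max{σ(l) : l∈U(H)(e_2)}. Then for every e∈H and every ordering σ of U(H), Σ_{l∈U(H)(e)} m^σ_l(U(H),w) = m^{g(σ)}_e(H,v^N), where m^σ_l(M,u)=u(σ^l∪{l})−u(σ^l) denotes the marginal contribution of l in the ordering σ (σ^l the set of players preceding l). Moreover, m^σ_l(U(H),w)=m^{g(σ)}_e(H,v^N) if σ(l)=max{σ(k) : k∈U(H)(e)}, and m^σ_l(U(H),w)=0 for every other l∈U(H)(e). -/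
open scoped Classical
open Finset

noncomputable section

namespace HGGame

/-! ## Generic hypergraph notions -/

variable {α : Type*}

/-! ## Hypergraph communication situations -/

variable {N : Type*} [Fintype N] [DecidableEq N]

/-- `marginal` computed with an arbitrary `DecidableEq` instance on the players. -/
theorem marginal_eq_sub {M : Type*} [Fintype M] [DecidableEq M] (u : Finset M → ℝ)
    (σ : M ≃ Fin (Fintype.card M)) (i : M) :
    marginal u σ i = u (insert i (preceding σ i)) - u (preceding σ i) := by
  rw [marginal]
  congr!

theorem mem_UHe {H : Finset (Finset N)} {e : Finset N} {l : UElem N} :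
    l ∈ UHe H e ↔ l.1 ∈ e ∧ l.2.1 = e ∧ 1 ≤ l.2.2 ∧ l.2.2 ≤ eta H / e.card := by
  obtain ⟨i, f, k⟩ := l
  simp only [UHe, UHie, mem_biUnion, mem_image, mem_Icc, Prod.mk.injEq]
  constructor
  · rintro ⟨_, hi, _, hk, rfl, rfl, rfl⟩
    exact ⟨hi, rfl, hk⟩
  · rintro ⟨hi, rfl, hk⟩
    exact ⟨i, hi, k, hk, rfl, rfl, rfl⟩

theorem UHe_subset_UH {H : Finset (Finset N)} {e : Finset N} (he : e ∈ H) :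
    UHe H e ⊆ UH H := by
  intro l hl
  simp only [UHe, mem_biUnion] at hl
  obtain ⟨i, hi, hl⟩ := hl
  simp only [UH, UHi, mem_biUnion, mem_univ, true_and, mem_filter]
  exact ⟨i, e, ⟨he, hi⟩, hl⟩

theorem UHe_nonempty {H : Finset (Finset N)} (hH : ∀ e ∈ H, 1 < e.card)
    {e : Finset N} (he : e ∈ H) : (UHe H e).Nonempty := by
  have hpos : 0 < e.card := by have := hH e he; omega
  obtain ⟨i, hi⟩ := card_pos.mp hpos
  have heta : eta H ≠ 0 := by
    rw [eta, Ne, Finset.lcm_eq_zero_iff]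
    rintro ⟨f, hf, hf0⟩
    have := hH f hf
    omega
  have hle : e.card ≤ eta H :=
    Nat.le_of_dvd (Nat.pos_of_ne_zero heta) (Finset.dvd_lcm he)
  exact ⟨(i, e, 1), mem_UHe.mpr ⟨hi, rfl, le_rfl, Nat.div_pos hle hpos⟩⟩

/-- The agents of the hyperlink `e`, as players of the uniform hyperlink game. -/
def agents (H : Finset (Finset N)) (e : Finset N) : Finset {l // l ∈ UH H} :=
  (UH H).attach.filter fun l => l.val ∈ UHe H e

theorem mem_agents {H : Finset (Finset N)} {e : Finset N} {l : {l // l ∈ UH H}} :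
    l ∈ agents H e ↔ l.val ∈ UHe H e := by
  simp [agents]

theorem agents_nonempty {H : Finset (Finset N)} (hH : ∀ e ∈ H, 1 < e.card)
    {e : Finset N} (he : e ∈ H) : (agents H e).Nonempty := by
  obtain ⟨l, hl⟩ := UHe_nonempty hH he
  exact ⟨⟨l, UHe_subset_UH he hl⟩, mem_agents.mpr hl⟩

theorem eq_of_mem_agents {H : Finset (Finset N)} {e f : Finset N} {l : {l // l ∈ UH H}}
    (he : l ∈ agents H e) (hf : l ∈ agents H f) : e = f :=
  (mem_UHe.mp (mem_agents.mp he)).2.1.symm.trans (mem_UHe.mp (mem_agents.mp hf)).2.1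

/-- The position of the last agent of the hyperlink `e` in the ordering `σ`. -/
def lastPos {H : Finset (Finset N)}
    (σ : {l // l ∈ UH H} ≃ Fin (Fintype.card {l // l ∈ UH H})) (e : Finset N) : ℕ :=
  (agents H e).sup fun l => (σ l : ℕ)

theorem mem_Hof_image {H : Finset (Finset N)} {F : Finset {l // l ∈ UH H}} {f : Finset N} :
    f ∈ Hof H (F.image Subtype.val) ↔ f ∈ H ∧ agents H f ⊆ F := by
  rw [Hof, mem_filter]
  refine and_congr_right fun hf => ⟨fun h l hl => ?_, fun h l hl => ?_⟩
  · obtain ⟨k, hk, hkl⟩ := mem_image.mp (h (mem_agents.mp hl))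
    rwa [← Subtype.ext hkl]
  · exact mem_image.mpr ⟨⟨l, UHe_subset_UH hf hl⟩, h (mem_agents.mpr hl), rfl⟩

section Ordering

variable {H : Finset (Finset N)}
  (σ : {l // l ∈ UH H} ≃ Fin (Fintype.card {l // l ∈ UH H}))

theorem exists_agent_eq_lastPos (hH : ∀ e ∈ H, 1 < e.card) {e : Finset N} (he : e ∈ H) :
    ∃ l ∈ agents H e, (σ l : ℕ) = lastPos σ e := by
  obtain ⟨l, hl, h⟩ := exists_mem_eq_sup _ (agents_nonempty hH he) fun l => (σ l : ℕ)
  exact ⟨l, hl, h.symm⟩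

theorem le_lastPos {e : Finset N} {l : {l // l ∈ UH H}} (hl : l ∈ agents H e) :
    (σ l : ℕ) ≤ lastPos σ e :=
  le_sup (f := fun l => (σ l : ℕ)) hl

theorem mem_Hof_preceding (hH : ∀ e ∈ H, 1 < e.card) {l : {l // l ∈ UH H}} {f : Finset N} :
    f ∈ Hof H ((preceding σ l).image Subtype.val) ↔ f ∈ H ∧ lastPos σ f < σ l := by
  rw [mem_Hof_image]
  refine and_congr_right fun hf => ⟨fun h => ?_, fun h k hk => ?_⟩
  · obtain ⟨k, hk, hlast⟩ := exists_agent_eq_lastPos σ hH hf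
    have := h hk
    rw [preceding, mem_filter, Fin.lt_def, hlast] at this
    exact this.2
  · rw [preceding, mem_filter, Fin.lt_def]
    exact ⟨mem_univ _, (le_lastPos σ hk).trans_lt h⟩

theorem mem_Hof_insert_preceding {l : {l // l ∈ UH H}} {f : Finset N} :
    f ∈ Hof H ((insert l (preceding σ l)).image Subtype.val) ↔
      f ∈ H ∧ lastPos σ f ≤ σ l := by
  rw [mem_Hof_image]
  refine and_congr_right fun _ => ?_
  rw [lastPos, Finset.sup_le_iff]
  refine forall₂_congr fun k _ => ?_
  rw [mem_insert, preceding, mem_filter, le_iff_eq_or_lt, Fin.lt_def, ← Fin.ext_iff,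
    σ.injective.eq_iff]
  simp

theorem marginal_uGame_eq_zero (v : Finset N → ℝ) (hH : ∀ e ∈ H, 1 < e.card)
    {e : Finset N} {l : {l // l ∈ UH H}} (hl : l ∈ agents H e)
    (hne : (σ l : ℕ) ≠ lastPos σ e) : marginal (uGame v H) σ l = 0 := by
  have hset : Hof H ((insert l (preceding σ l)).image Subtype.val)
      = Hof H ((preceding σ l).image Subtype.val) := by
    ext f
    rw [mem_Hof_insert_preceding, mem_Hof_preceding σ hH]
    refine and_congr_right fun hf => ⟨fun h => h.lt_of_ne fun heq => ?_, le_of_lt⟩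
    obtain ⟨k, hk, hlast⟩ := exists_agent_eq_lastPos σ hH hf
    obtain rfl : k = l := σ.injective (Fin.ext (hlast.trans heq))
    obtain rfl := eq_of_mem_agents hl hk
    exact hne hlast
  rw [marginal_eq_sub, uGame, uGame, uw, uw, hset, sub_self]

theorem marginal_uGame_eq_marginal_confGame (v : Finset N → ℝ) (hH : ∀ e ∈ H, 1 < e.card)
    (τ : {e // e ∈ H} ≃ Fin (Fintype.card {e // e ∈ H}))
    (hτ : ∀ e₁ e₂ : {e // e ∈ H}, τ e₁ < τ e₂ ↔ lastPos σ e₁.val < lastPos σ e₂.val)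
    {e : Finset N} (he : e ∈ H) {l : {l // l ∈ UH H}} (hlast : (σ l : ℕ) = lastPos σ e) :
    marginal (uGame v H) σ l = marginal (confGame v H) τ ⟨e, he⟩ := by
  have hpre : Hof H ((preceding σ l).image Subtype.val)
      = (preceding τ ⟨e, he⟩).image Subtype.val := by
    ext f
    rw [mem_Hof_preceding σ hH, hlast]
    simp [preceding, hτ, and_comm]
  have hins : Hof H ((insert l (preceding σ l)).image Subtype.val)
      = (insert ⟨e, he⟩ (preceding τ ⟨e, he⟩)).image Subtype.val := by
    ext f
    have hle (hf : f ∈ H) : lastPos σ f ≤ lastPos σ e ↔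
        (⟨f, hf⟩ : {e // e ∈ H}) = ⟨e, he⟩ ∨ τ ⟨f, hf⟩ < τ ⟨e, he⟩ := by
      rw [← not_lt, ← hτ ⟨e, he⟩ ⟨f, hf⟩, not_lt, le_iff_eq_or_lt, τ.injective.eq_iff]
    rw [mem_Hof_insert_preceding, hlast, mem_image]
    simp only [mem_insert, preceding, mem_filter, mem_univ, true_and]
    constructor
    · rintro ⟨hf, h⟩
      exact ⟨⟨f, hf⟩, (hle hf).mp h, rfl⟩
    · rintro ⟨⟨f, hf⟩, h, rfl⟩
      exact ⟨hf, (hle hf).mpr h⟩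
  simp only [marginal_eq_sub, uGame, uw, confGame, hpre, hins]

end Ordering

/-- Marginal contributions in the uniform hyperlink game aggregate to marginal
contributions in the conference game under the induced ordering `g(σ)`:
if `τ = g(σ)` is the ordering of `H` ranking hyperlinks by the maximal `σ`-position of
their agents, then `Σ_{l ∈ U(H)(e)} m^σ_l(U(H),w) = m^{g(σ)}_e(H,v^N)`; moreover the
agent of `U(H)(e)` placed last by `σ` carries the whole marginal contribution and every
other agent of `U(H)(e)` has zero marginal contribution. -/
theorem uniform_hyperlink_marginal_aggregates
    {N : Type*} [Fintype N] [DecidableEq N]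
    (v : Finset N → ℝ) (H : Finset (Finset N))
    (hN : 2 ≤ Fintype.card N)
    (hv0 : v ∅ = 0) (hzn : ∀ i : N, v {i} = 0)
    (hH : ∀ e ∈ H, 1 < e.card)
    (σ : {l // l ∈ UH H} ≃ Fin (Fintype.card {l // l ∈ UH H}))
    (τ : {e // e ∈ H} ≃ Fin (Fintype.card {e // e ∈ H}))
    (hτ : ∀ e₁ e₂ : {e // e ∈ H}, τ e₁ < τ e₂ ↔
      ((UH H).attach.filter (fun l => l.val ∈ UHe H e₁.val)).sup (fun l => (σ l : ℕ)) <
      ((UH H).attach.filter (fun l => l.val ∈ UHe H e₂.val)).sup (fun l => (σ l : ℕ)))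
    (e : Finset N) (he : e ∈ H) :
    (∑ l ∈ (UH H).attach.filter (fun l => l.val ∈ UHe H e),
        marginal (uGame v H) σ l)
      = marginal (confGame v H) τ ⟨e, he⟩
    ∧ ∀ l ∈ (UH H).attach.filter (fun l => l.val ∈ UHe H e),
        ((σ l : ℕ) =
            ((UH H).attach.filter (fun k => k.val ∈ UHe H e)).sup (fun k => (σ k : ℕ)) →
          marginal (uGame v H) σ l = marginal (confGame v H) τ ⟨e, he⟩)
        ∧ ((σ l : ℕ) ≠
            ((UH H).attach.filter (fun k => k.val ∈ UHe H e)).sup (fun k => (σ k : ℕ)) →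
          marginal (uGame v H) σ l = 0) := by
  have hzero : ∀ l ∈ agents H e, (σ l : ℕ) ≠ lastPos σ e → marginal (uGame v H) σ l = 0 :=
    fun _ hl hne => marginal_uGame_eq_zero σ v hH hl hne
  have hmax : ∀ l, (σ l : ℕ) = lastPos σ e →
      marginal (uGame v H) σ l = marginal (confGame v H) τ ⟨e, he⟩ :=
    fun _ => marginal_uGame_eq_marginal_confGame σ v hH τ hτ he
  refine ⟨?_, fun l hl => ⟨hmax l, hzero l hl⟩⟩
  obtain ⟨l, hl, hlast⟩ := exists_agent_eq_lastPos σ hH he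
  rw [← hmax l hlast]
  refine sum_eq_single_of_mem l hl fun k hk hkl => hzero k hk fun hk' => hkl ?_
  exact σ.injective (Fin.ext (hk'.trans hlast.symm))

end HGGame
end
end
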